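/- arXiv:2602.05674 — 7 statements merged into one kernel-verified Lean document; each statement's English description precedes it below -/
import Mathlib

section
/- For every integer ℓ ≥ 2, the matrix S⁺_ℓ is the Moore–Penrose pseudoinverse of the subtraction matrix S_ℓ; that is, the four Penrose conditions hold: S_ℓ S⁺_ℓ S_ℓ = S_ℓ, S⁺_ℓ S_ℓ S⁺_ℓ = S⁺_ℓ, (S_ℓ S⁺_ℓ)ᵀ = S_ℓ S⁺_ℓ, and (S⁺_ℓ S_ℓ)ᵀ = S⁺_ℓ S_ℓ. -/
open Matrix

/-- The subtraction matrix `S_ℓ ∈ ℝ^{(ℓ-1)×ℓ}`: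
`S_ℓ[i,0] = -1`, `S_ℓ[i,i+1] = 1`, all other entries `0`. -/
def subMat (ℓ : ℕ) : Matrix (Fin (ℓ - 1)) (Fin ℓ) ℝ :=
  Matrix.of fun i j =>
    if (j : ℕ) = 0 then -1 else if (j : ℕ) = (i : ℕ) + 1 then 1 else 0

/-- The matrix `S⁺_ℓ ∈ ℝ^{ℓ×(ℓ-1)}`: a zero row stacked on top of `I_{ℓ-1}`,
minus `(1/ℓ)` times the all-ones matrix. -/
noncomputable def subPinv (ℓ : ℕ) : Matrix (Fin ℓ) (Fin (ℓ - 1)) ℝ :=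
  Matrix.of fun i j =>
    (if (i : ℕ) = (j : ℕ) + 1 then (1 : ℝ) else 0) - (ℓ : ℝ)⁻¹

theorem subMat_mul_subPinv (n : ℕ) : subMat (n + 1) * subPinv (n + 1) = 1 := by
  ext (i : Fin n) (j : Fin n)
  change ∑ k : Fin (n + 1), subMat (n + 1) i k * subPinv (n + 1) k j = _
  simp [subMat, subPinv, Fin.sum_univ_succ, Matrix.one_apply, ← Fin.ext_iff]

theorem subPinv_mul_subMat (n : ℕ) :
    subPinv (n + 1) * subMat (n + 1) = 1 - Matrix.of fun _ _ => ((n + 1 : ℕ) : ℝ)⁻¹ := by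
  have hn : (n : ℝ) + 1 ≠ 0 := by positivity
  ext i j
  change ∑ k : Fin n, subPinv (n + 1) i k * subMat (n + 1) k j = _
  induction i using Fin.cases <;> induction j using Fin.cases <;>
    simp [subMat, subPinv, Matrix.one_apply, ← Fin.ext_iff, Fin.succ_ne_zero,
      (Fin.succ_ne_zero _).symm]
  all_goals field_simp
  all_goals ring

/-- For every `ℓ ≥ 2`, `S⁺_ℓ` is the Moore–Penrose pseudoinverse of `S_ℓ`:
the four Penrose conditions hold. -/
theorem subPinv_is_moore_penrose (ℓ : ℕ) (hℓ : 2 ≤ ℓ) :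
    subMat ℓ * subPinv ℓ * subMat ℓ = subMat ℓ ∧
    subPinv ℓ * subMat ℓ * subPinv ℓ = subPinv ℓ ∧
    (subMat ℓ * subPinv ℓ)ᵀ = subMat ℓ * subPinv ℓ ∧
    (subPinv ℓ * subMat ℓ)ᵀ = subPinv ℓ * subMat ℓ := by
  obtain ⟨n, rfl⟩ : ∃ n, ℓ = n + 1 := ⟨ℓ - 1, by omega⟩
  have h := subMat_mul_subPinv n
  refine ⟨by rw [h, Matrix.one_mul], by rw [Matrix.mul_assoc, h, Matrix.mul_one],
    by rw [h, Matrix.transpose_one], ?_⟩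
  rw [subPinv_mul_subMat, Matrix.transpose_sub, Matrix.transpose_one]
  rfl
end

section
/- For all subsets τ ⊆ γ ⊆ {1,…,d}, the residual query matrix factors through the marginal query matrix: T_{τ,γ} · M_γ = R_τ. Consequently, the τ-residual of a data vector can be computed from the γ-marginal for any γ containing τ. -/
open Matrix Finset

/-- Entry of the subtraction matrix `S_ℓ` (0-indexed):
column `0` gives `-1`, column `i+1` gives `1`, all other entries `0`. -/
def sEnt (i j : ℕ) : ℝ := if j = 0 then -1 else if j = i + 1 then 1 else 0

/-- Entry of `S⁺_ℓ`: a zero row stacked on `I_{ℓ-1}`, minus `1/ℓ` everywhere. -/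
noncomputable def spEnt (ℓ i j : ℕ) : ℝ :=
  (if i = j + 1 then (1 : ℝ) else 0) - (ℓ : ℝ)⁻¹

/-- Residual index sizes: `n k − 1` for `k ∈ τ`, and `1` otherwise. -/
def rIdx {d : ℕ} (n : Fin d → ℕ) (τ : Finset (Fin d)) (k : Fin d) : ℕ :=
  if k ∈ τ then n k - 1 else 1

/-- Marginal index sizes: `n k` for `k ∈ γ`, and `1` otherwise. -/
def mIdx {d : ℕ} (n : Fin d → ℕ) (γ : Finset (Fin d)) (k : Fin d) : ℕ :=
  if k ∈ γ then n k else 1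

/-- The decomposition matrix `T_{τ,γ} = ⊠_k C_k` with `C_k = S_{n_k}` for
`k ∈ τ`, `C_k = 1ᵀ_{n_k}` (all-ones row) for `k ∈ γ∖τ`, and `C_k = [1]`
for `k ∉ γ`, realized entrywise via the tensor (Kronecker) product. -/
def Tmat {d : ℕ} (n : Fin d → ℕ) (τ γ : Finset (Fin d)) :
    Matrix (∀ k, Fin (rIdx n τ k)) (∀ k, Fin (mIdx n γ k)) ℝ :=
  Matrix.of fun i j => ∏ k, if k ∈ τ then sEnt (i k) (j k) else (1 : ℝ)

/-- The matrix `T⁺_{τ,γ} = ⊠_k D_k` with `D_k = S⁺_{n_k}` for `k ∈ τ`,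
`D_k = (1/n_k)·1_{n_k}` (constant column) for `k ∈ γ∖τ`, and `D_k = [1]`
for `k ∉ γ`. -/
noncomputable def Tpinv {d : ℕ} (n : Fin d → ℕ) (τ γ : Finset (Fin d)) :
    Matrix (∀ k, Fin (mIdx n γ k)) (∀ k, Fin (rIdx n τ k)) ℝ :=
  Matrix.of fun i j => ∏ k,
    if k ∈ τ then spEnt (n k) (i k) (j k)
    else if k ∈ γ then ((n k : ℝ))⁻¹ else (1 : ℝ)

/-- The marginal query matrix `M_γ = ⊠_k E_k` with `E_k = I_{n_k}` for
`k ∈ γ` and `E_k = 1ᵀ_{n_k}` otherwise. -/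
def Mmat {d : ℕ} (n : Fin d → ℕ) (γ : Finset (Fin d)) :
    Matrix (∀ k, Fin (mIdx n γ k)) (∀ k, Fin (n k)) ℝ :=
  Matrix.of fun i j => ∏ k,
    if k ∈ γ then (if (i k : ℕ) = (j k : ℕ) then (1 : ℝ) else 0) else (1 : ℝ)

/-- The residual query matrix `R_τ = ⊠_k F_k` with `F_k = S_{n_k}` for
`k ∈ τ` and `F_k = 1ᵀ_{n_k}` otherwise. -/
def Rmat {d : ℕ} (n : Fin d → ℕ) (τ : Finset (Fin d)) :
    Matrix (∀ k, Fin (rIdx n τ k)) (∀ k, Fin (n k)) ℝ :=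
  Matrix.of fun i j => ∏ k, if k ∈ τ then sEnt (i k) (j k) else (1 : ℝ)

/-- Summing `f` over the `k`-th index of a `γ`-marginal against the `k`-th factor of `Mmat n γ`
evaluates `f` at the selected column when `k ∈ γ`, and at the only index otherwise. -/
theorem sum_mIdx_mul_ite {d : ℕ} (n : Fin d → ℕ) (γ : Finset (Fin d)) (k : Fin d) (f : ℕ → ℝ)
    {j : ℕ} (hj : j < n k) :
    ∑ x : Fin (mIdx n γ k), f x * (if k ∈ γ then (if (x : ℕ) = j then (1 : ℝ) else 0) else 1) =
      if k ∈ γ then f j else f 0 := by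
  rw [Fin.sum_univ_eq_sum_range
    (fun x => f x * (if k ∈ γ then (if x = j then (1 : ℝ) else 0) else 1)) (mIdx n γ k)]
  by_cases hk : k ∈ γ <;> simp [mIdx, hk, hj]

/-- For all `τ ⊆ γ ⊆ {1,…,d}`, the residual query matrix factors through the
marginal query matrix: `T_{τ,γ} · M_γ = R_τ`. -/
theorem Tmat_mul_Mmat (d : ℕ) (hd : 1 ≤ d) (n : Fin d → ℕ) (hn : ∀ k, 2 ≤ n k)
    (τ γ : Finset (Fin d)) (hτγ : τ ⊆ γ) :
    Tmat n τ γ * Mmat n γ = Rmat n τ := by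
  ext i j
  simp only [Tmat, Mmat, Rmat, Matrix.mul_apply, Matrix.of_apply, ← Finset.prod_mul_distrib]
  rw [← Fintype.piFinset_univ, ← Finset.prod_univ_sum (fun _ => Finset.univ)
    (fun k (x : Fin (mIdx n γ k)) => (if k ∈ τ then sEnt (i k) x else (1 : ℝ)) *
      (if k ∈ γ then (if (x : ℕ) = (j k : ℕ) then (1 : ℝ) else 0) else 1))]
  refine Finset.prod_congr rfl fun k _ => ?_
  rw [sum_mIdx_mul_ite n γ k (fun x => if k ∈ τ then sEnt (i k) x else 1) (j k).isLt]
  by_cases hτ : k ∈ τ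
  · simp [hτ, hτγ hτ]
  · simp [hτ]
end

section
/- For all subsets τ ⊆ γ ⊆ {1,…,d}, the matrix product T_{τ,γ} · T⁺_{τ,γ} equals the identity matrix on the residual index space (the index type ∏_{k=1}^d Fin s_k with s_k = n_k − 1 for k ∈ τ and s_k = 1 otherwise); that is, T⁺_{τ,γ} is a right inverse of T_{τ,γ}. -/
open Matrix Finset

/-- The row `i` of `S_ℓ` takes the difference of the entries `i + 1` and `0`. -/
lemma sum_sEnt_mul {ℓ i : ℕ} (hi : i + 1 < ℓ) (f : ℕ → ℝ) :
    ∑ x : Fin ℓ, sEnt i x * f x = f (i + 1) - f 0 := by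
  obtain ⟨m, rfl⟩ : ∃ m, ℓ = m + 1 := ⟨ℓ - 1, by omega⟩
  rw [Fin.sum_univ_eq_sum_range (fun x => sEnt i x * f x), Finset.sum_range_succ']
  have hm : i < m := by omega
  simp [sEnt, hm]
  ring

/-- The product `S_ℓ S⁺_ℓ` is the identity, entrywise. -/
lemma sum_sEnt_mul_spEnt {ℓ i : ℕ} (hi : i + 1 < ℓ) (j : ℕ) :
    ∑ x : Fin ℓ, sEnt i x * spEnt ℓ x j = if i = j then 1 else 0 := by
  rw [sum_sEnt_mul hi (fun x => spEnt ℓ x j)]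
  simp [spEnt]

/-- Each tensor factor of `T_{τ,γ} T⁺_{τ,γ}` is an identity matrix. -/
lemma sum_factor_mul {d : ℕ} {n : Fin d → ℕ} (hn : ∀ k, 2 ≤ n k)
    {τ γ : Finset (Fin d)} (hτγ : τ ⊆ γ) (k : Fin d) (i j : Fin (rIdx n τ k)) :
    ∑ x : Fin (mIdx n γ k), (if k ∈ τ then sEnt i x else (1 : ℝ)) *
      (if k ∈ τ then spEnt (n k) x j else if k ∈ γ then ((n k : ℝ))⁻¹ else (1 : ℝ)) =
      if i = j then 1 else 0 := by
  have hi := i.isLt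
  have hj := j.isLt
  have hk := hn k
  simp only [Fin.ext_iff]
  generalize (i : ℕ) = a at *
  generalize (j : ℕ) = b at *
  by_cases hτ : k ∈ τ
  · have hm : mIdx n γ k = n k := if_pos (hτγ hτ)
    simp only [rIdx, hτ, if_true] at hi ⊢
    rw [hm]
    exact sum_sEnt_mul_spEnt (by omega) b
  · simp only [rIdx, hτ, if_false] at hi hj
    obtain rfl : a = b := by omega
    have hk0 : (n k : ℝ) ≠ 0 := by
      exact_mod_cast (by omega : n k ≠ 0)
    simp only [hτ, if_false, Finset.sum_const, Finset.card_univ, Fintype.card_fin]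
    by_cases hγ : k ∈ γ <;> simp [mIdx, hγ, hk0]

/-- For all `τ ⊆ γ ⊆ {1,…,d}`, `T_{τ,γ} · T⁺_{τ,γ}` is the identity matrix
on the residual index space: `T⁺_{τ,γ}` is a right inverse of `T_{τ,γ}`. -/
theorem Tmat_mul_Tpinv (d : ℕ) (hd : 1 ≤ d) (n : Fin d → ℕ) (hn : ∀ k, 2 ≤ n k)
    (τ γ : Finset (Fin d)) (hτγ : τ ⊆ γ) :
    Tmat n τ γ * Tpinv n τ γ =
      (1 : Matrix (∀ k, Fin (rIdx n τ k)) (∀ k, Fin (rIdx n τ k)) ℝ) := by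
  ext i j
  simp only [Matrix.mul_apply, Tmat, Tpinv, Matrix.of_apply, ← Finset.prod_mul_distrib]
  rw [← Fintype.prod_sum (fun k (x : Fin (mIdx n γ k)) =>
    (if k ∈ τ then sEnt (i k) x else (1 : ℝ)) *
      (if k ∈ τ then spEnt (n k) x (j k) else if k ∈ γ then ((n k : ℝ))⁻¹ else (1 : ℝ)))]
  simp only [sum_factor_mul hn hτγ, Matrix.one_apply, funext_iff, Fintype.prod_ite_zero,
    Finset.prod_const_one]
end

section
/- For any two distinct subsets τ, τ′ ⊆ γ ⊆ {1,…,d} with τ ≠ τ′, the matrix product T_{τ,γ} · T⁺_{τ′,γ} is the zero matrix. -/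
open Matrix Finset

/-- Each row of the subtraction matrix `S_ℓ` sums to zero. -/
theorem sum_range_sEnt {ℓ i : ℕ} (hi : i + 1 < ℓ) : ∑ x ∈ range ℓ, sEnt i x = 0 := by
  have h (x : ℕ) :
      sEnt i x = (if x = i + 1 then (1 : ℝ) else 0) - (if x = 0 then 1 else 0) := by
    unfold sEnt
    split_ifs <;> first | omega | norm_num
  simp [h, hi, show 0 < ℓ by omega]

/-- Each column of `S⁺_ℓ` sums to zero. -/
theorem sum_range_spEnt {ℓ j : ℕ} (hj : j + 1 < ℓ) : ∑ x ∈ range ℓ, spEnt ℓ x j = 0 := by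
  have hℓ : (ℓ : ℝ) ≠ 0 := Nat.cast_ne_zero.mpr (by omega)
  simp [spEnt, hj, hℓ]

/-- The entries of `T_{τ,γ} T⁺_{τ',γ}` factor over the attributes. -/
theorem Tmat_mul_Tpinv_apply {d : ℕ} (n : Fin d → ℕ) (τ τ' γ : Finset (Fin d))
    (i : ∀ k, Fin (rIdx n τ k)) (j : ∀ k, Fin (rIdx n τ' k)) :
    (Tmat n τ γ * Tpinv n τ' γ) i j =
      ∏ k, ∑ x ∈ range (mIdx n γ k), (if k ∈ τ then sEnt (i k) x else (1 : ℝ)) *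
        (if k ∈ τ' then spEnt (n k) x (j k)
          else if k ∈ γ then ((n k : ℝ))⁻¹ else (1 : ℝ)) := by
  simp only [← Fin.sum_univ_eq_sum_range]
  rw [Fintype.prod_sum]
  simp only [Matrix.mul_apply, Tmat, Tpinv, Matrix.of_apply, prod_mul_distrib]

/-- For distinct subsets `τ, τ′ ⊆ γ ⊆ {1,…,d}`, the product
`T_{τ,γ} · T⁺_{τ′,γ}` is the zero matrix. -/
theorem Tmat_mul_Tpinv_ne (d : ℕ) (hd : 1 ≤ d) (n : Fin d → ℕ) (hn : ∀ k, 2 ≤ n k)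
    (τ τ' γ : Finset (Fin d)) (hτγ : τ ⊆ γ) (hτ'γ : τ' ⊆ γ) (hne : τ ≠ τ') :
    Tmat n τ γ * Tpinv n τ' γ = 0 := by
  ext i j
  rw [Tmat_mul_Tpinv_apply, Matrix.zero_apply]
  obtain ⟨k, hk⟩ : ∃ k, ¬(k ∈ τ ↔ k ∈ τ') := by
    simpa [Finset.ext_iff] using hne
  apply prod_eq_zero (mem_univ k)
  by_cases hτ : k ∈ τ
  · have hτ' : k ∉ τ' := fun h => hk (iff_of_true hτ h)
    have hi : (i k : ℕ) < n k - 1 := (i k).isLt.trans_eq (if_pos hτ)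
    simp only [mIdx, hτ, hτ', hτγ hτ, if_true, if_false]
    rw [← sum_mul, sum_range_sEnt (by omega), zero_mul]
  · have hτ' : k ∈ τ' := by tauto
    have hj : (j k : ℕ) < n k - 1 := (j k).isLt.trans_eq (if_pos hτ')
    simp only [mIdx, hτ, hτ', hτ'γ hτ', if_true, if_false, one_mul]
    exact sum_range_spEnt (by omega)
end

section
/- For every subset γ ⊆ {1,…,d}, the sum over all subsets τ ⊆ γ of the matrix products T⁺_{τ,γ} · T_{τ,γ} equals the identity matrix on the marginal index space ∏_{k=1}^d Fin m_k (where m_k = n_k for k ∈ γ and m_k = 1 otherwise): ∑_{τ ⊆ γ} T⁺_{τ,γ} T_{τ,γ} = I. -/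
open Matrix Finset

/-- Entrywise form of `S⁺_ℓ S_ℓ = I - (1/ℓ) J`, with `J` the all-ones matrix. -/
theorem sum_spEnt_mul_sEnt {l a b : ℕ} (ha : a < l) (hb : b < l) :
    ∑ x : Fin (l - 1), spEnt l a x * sEnt x b = (if a = b then (1 : ℝ) else 0) - (l : ℝ)⁻¹ := by
  obtain ⟨m, rfl⟩ : ∃ m, l = m + 1 := ⟨l - 1, by omega⟩
  rw [Nat.add_sub_cancel, Fin.sum_univ_eq_sum_range (fun x => spEnt (m + 1) a x * sEnt x b) m]
  rcases b with _ | b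
  · have h : ((m : ℝ) + 1) ≠ 0 := by positivity
    rcases a with _ | a
    · simp [spEnt, sEnt]
      field_simp
      ring
    · have ham : a < m := by omega
      simp [spEnt, sEnt, Finset.sum_sub_distrib, ham]
      field_simp
      ring
  · have hbm : b < m := by omega
    simp [spEnt, sEnt, hbm]

/-- The entries of `T⁺_{τ,γ} T_{τ,γ}` factor over the coordinates. -/
theorem Tpinv_mul_Tmat_apply {d : ℕ} (n : Fin d → ℕ) {τ γ : Finset (Fin d)} (hτ : τ ⊆ γ)
    (a b : ∀ k, Fin (mIdx n γ k)) :
    (Tpinv n τ γ * Tmat n τ γ) a b =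
      (∏ k ∈ τ, ((if (a k : ℕ) = b k then (1 : ℝ) else 0) - (n k : ℝ)⁻¹)) *
        ∏ k ∈ γ \ τ, (n k : ℝ)⁻¹ := by
  have factor (k : Fin d) :
      (∑ x : Fin (rIdx n τ k),
        (if k ∈ τ then spEnt (n k) (a k) x else if k ∈ γ then ((n k : ℝ))⁻¹ else 1) *
          (if k ∈ τ then sEnt x (b k) else (1 : ℝ))) =
      (if k ∈ τ then (if (a k : ℕ) = b k then (1 : ℝ) else 0) - (n k : ℝ)⁻¹ else 1) *
        (if k ∈ γ \ τ then (n k : ℝ)⁻¹ else 1) := by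
    by_cases hk : k ∈ τ
    · have hm : mIdx n γ k = n k := if_pos (hτ hk)
      have hr : rIdx n τ k = n k - 1 := if_pos hk
      simp only [hk, if_true, mem_sdiff, not_true, and_false, if_false, mul_one]
      rw [hr]
      exact sum_spEnt_mul_sEnt (hm ▸ (a k).isLt) (hm ▸ (b k).isLt)
    · have hr : rIdx n τ k = 1 := if_neg hk
      simp [hk, hr]
  simp only [Matrix.mul_apply, Tpinv, Tmat, Matrix.of_apply, ← prod_mul_distrib]
  rw [← Fintype.prod_sum (fun k (x : Fin (rIdx n τ k)) =>
    (if k ∈ τ then spEnt (n k) (a k) x else if k ∈ γ then ((n k : ℝ))⁻¹ else 1) *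
      (if k ∈ τ then sEnt x (b k) else (1 : ℝ))), prod_congr rfl fun k _ => factor k,
    prod_mul_distrib, Fintype.prod_ite_mem, Fintype.prod_ite_mem]

/-- For every `γ ⊆ {1,…,d}`, the sum over all subsets `τ ⊆ γ` of
`T⁺_{τ,γ} · T_{τ,γ}` equals the identity matrix on the marginal index space. -/
theorem sum_Tpinv_mul_Tmat (d : ℕ) (hd : 1 ≤ d) (n : Fin d → ℕ)
    (hn : ∀ k, 2 ≤ n k) (γ : Finset (Fin d)) :
    ∑ τ ∈ γ.powerset, Tpinv n τ γ * Tmat n τ γ =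
      (1 : Matrix (∀ k, Fin (mIdx n γ k)) (∀ k, Fin (mIdx n γ k)) ℝ) := by
  ext a b
  rw [Matrix.sum_apply,
    sum_congr rfl fun τ hτ => Tpinv_mul_Tmat_apply n (mem_powerset.mp hτ) a b, ← prod_add]
  simp only [sub_add_cancel]
  have key : (∀ k ∈ γ, (a k : ℕ) = b k) ↔ a = b := by
    refine ⟨fun h => funext fun k => Fin.ext ?_, fun h k _ => by rw [h]⟩
    by_cases hk : k ∈ γ
    · exact h k hk
    · have hm : mIdx n γ k = 1 := if_neg hk
      have := (a k).isLt
      have := (b k).isLt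
      omega
  simp only [prod_ite_zero, prod_const_one, Matrix.one_apply, key]
end

section
/- (Privacy-cost computation.) For every subset τ ⊆ {1,…,d}, the matrix V_τ := T_{τ,τ} T_{τ,τ}ᵀ is invertible, and every diagonal entry of the matrix R_τᵀ V_τ⁻¹ R_τ equals p_τ := ∏_{i ∈ τ} (n_i − 1)/n_i. (In particular, the largest diagonal entry of R_τᵀ (σ² V_τ)⁻¹ R_τ is p_τ/σ², so releasing the noisy residual satisfies (p_τ/(2σ²))-zCDP.) -/
open Matrix Finset

/-- The tensor product of a finite family of matrices. -/
def piKronecker {ι : Type*} [Fintype ι] {m n : ι → Type*} (A : ∀ k, Matrix (m k) (n k) ℝ) :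
    Matrix (∀ k, m k) (∀ k, n k) ℝ :=
  Matrix.of fun i j => ∏ k, A k (i k) (j k)

theorem piKronecker_transpose {ι : Type*} [Fintype ι] {m n : ι → Type*}
    (A : ∀ k, Matrix (m k) (n k) ℝ) :
    (piKronecker A)ᵀ = piKronecker fun k => (A k)ᵀ := rfl

theorem piKronecker_mul {ι : Type*} [Fintype ι] [DecidableEq ι] {l m n : ι → Type*}
    [∀ k, Fintype (m k)] (A : ∀ k, Matrix (l k) (m k) ℝ) (B : ∀ k, Matrix (m k) (n k) ℝ) :
    piKronecker A * piKronecker B = piKronecker fun k => A k * B k := by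
  ext i j
  simp only [piKronecker, Matrix.mul_apply, Matrix.of_apply]
  rw [Finset.prod_univ_sum, Fintype.piFinset_univ]
  simp only [Finset.prod_mul_distrib]

theorem piKronecker_one {ι : Type*} [Fintype ι] {m : ι → Type*}
    [∀ k, DecidableEq (m k)] [DecidableEq (∀ k, m k)] :
    piKronecker (fun k => (1 : Matrix (m k) (m k) ℝ)) = 1 := by
  ext i j
  simp only [piKronecker, Matrix.of_apply, Matrix.one_apply]
  by_cases h : i = j
  · subst h
    simp
  · rw [if_neg h]
    obtain ⟨k, hk⟩ := Function.ne_iff.mp h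
    exact Finset.prod_eq_zero (Finset.mem_univ k) (if_neg hk)

/-- The subtraction matrix with `m` rows and `l` columns. -/
def subMatrix (m l : ℕ) : Matrix (Fin m) (Fin l) ℝ :=
  Matrix.of fun i j => sEnt i j

/-- The inverse `1 - (m + 1)⁻¹ J` of the Gram matrix `1 + J`, where `J` is all ones. -/
noncomputable def subGramInv (m : ℕ) : Matrix (Fin m) (Fin m) ℝ :=
  Matrix.of fun i j => (if i = j then 1 else 0) - ((m : ℝ) + 1)⁻¹

theorem subMatrix_mul_transpose_apply (m : ℕ) (i j : Fin m) :
    (subMatrix m (m + 1) * (subMatrix m (m + 1))ᵀ) i j = (if i = j then 1 else 0) + 1 := by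
  simp [Matrix.mul_apply, subMatrix, sEnt, Fin.sum_univ_succ, Fin.val_inj, add_comm, eq_comm]

theorem subMatrix_gram_mul_inv (m : ℕ) :
    subMatrix m (m + 1) * (subMatrix m (m + 1))ᵀ * subGramInv m = 1 := by
  ext i j
  rw [Matrix.mul_apply]
  simp only [subMatrix_mul_transpose_apply, subGramInv, Matrix.of_apply, Matrix.one_apply,
    add_mul, mul_sub, Finset.sum_add_distrib, Finset.sum_sub_distrib]
  simp
  field_simp
  ring

theorem subMatrix_transpose_mul_inv_mul_apply_self (m : ℕ) (j : Fin (m + 1)) :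
    ((subMatrix m (m + 1))ᵀ * subGramInv m * subMatrix m (m + 1)) j j = m / ((m : ℝ) + 1) := by
  simp only [Matrix.mul_apply, subMatrix, subGramInv, Matrix.of_apply, Matrix.transpose_apply,
    mul_sub, Finset.sum_sub_distrib, sub_mul, ← Finset.sum_mul, ← Finset.mul_sum]
  refine Fin.cases ?_ (fun i => ?_) j
  · simp [sEnt]
    field_simp
    ring
  · simp [sEnt, Fin.val_inj]
    field_simp
    ring

/-- The tensor factors of `Tmat n τ τ` and of `Rmat n τ`. -/
def factorMatrix (p : Prop) [Decidable p] (m l : ℕ) : Matrix (Fin m) (Fin l) ℝ :=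
  Matrix.of fun i j => if p then sEnt i j else 1

/-- The inverse of the Gram matrix of `factorMatrix`. -/
noncomputable def factorGramInv (p : Prop) [Decidable p] (m : ℕ) : Matrix (Fin m) (Fin m) ℝ :=
  if p then subGramInv m else 1

theorem factorMatrix_gram_mul_inv (p : Prop) [Decidable p] {l : ℕ} (hl : 2 ≤ l) {m r : ℕ}
    (hm : m = if p then l - 1 else 1) (hr : r = if p then l else 1) :
    factorMatrix p m r * (factorMatrix p m r)ᵀ * factorGramInv p m = 1 := by
  by_cases hp : p
  · simp only [hp, if_true] at hm hr
    obtain rfl : r = m + 1 := by omega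
    simpa [factorMatrix, factorGramInv, hp, subMatrix] using subMatrix_gram_mul_inv m
  · simp only [hp, if_false] at hm hr
    subst hm hr
    ext i j
    obtain rfl := Subsingleton.elim 0 i
    obtain rfl := Subsingleton.elim 0 j
    simp [factorMatrix, factorGramInv, hp, Matrix.mul_apply]

theorem factorMatrix_transpose_mul_inv_mul_apply_self (p : Prop) [Decidable p] {l : ℕ}
    (hl : 2 ≤ l) {m : ℕ} (hm : m = if p then l - 1 else 1) (j : Fin l) :
    ((factorMatrix p m l)ᵀ * factorGramInv p m * factorMatrix p m l) j j =
      if p then ((l : ℝ) - 1) / l else 1 := by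
  by_cases hp : p
  · simp only [hp, if_true] at hm
    obtain rfl : l = m + 1 := by omega
    simpa [factorMatrix, factorGramInv, hp, subMatrix] using
      subMatrix_transpose_mul_inv_mul_apply_self m j
  · simp only [hp, if_false] at hm
    subst hm
    simp [factorMatrix, factorGramInv, hp, Matrix.mul_apply]

theorem Tmat_self_eq_piKronecker {d : ℕ} (n : Fin d → ℕ) (τ : Finset (Fin d)) :
    Tmat n τ τ = piKronecker fun k => factorMatrix (k ∈ τ) (rIdx n τ k) (mIdx n τ k) := rfl

theorem Rmat_eq_piKronecker {d : ℕ} (n : Fin d → ℕ) (τ : Finset (Fin d)) :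
    Rmat n τ = piKronecker fun k => factorMatrix (k ∈ τ) (rIdx n τ k) (n k) := rfl

theorem Tmat_gram_mul_inv {d : ℕ} {n : Fin d → ℕ} (hn : ∀ k, 2 ≤ n k) (τ : Finset (Fin d)) :
    Tmat n τ τ * (Tmat n τ τ)ᵀ *
      piKronecker (fun k => factorGramInv (k ∈ τ) (rIdx n τ k)) = 1 := by
  rw [Tmat_self_eq_piKronecker, piKronecker_transpose, piKronecker_mul, piKronecker_mul]
  simp only [factorMatrix_gram_mul_inv _ (hn _) (rfl : rIdx n τ _ = _) (rfl : mIdx n τ _ = _)]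
  exact piKronecker_one

/-- (Privacy-cost computation.) For every `τ ⊆ {1,…,d}`, the matrix
`V_τ := T_{τ,τ} T_{τ,τ}ᵀ` is invertible, and every diagonal entry of
`R_τᵀ V_τ⁻¹ R_τ` equals `p_τ = ∏_{i ∈ τ} (n_i − 1)/n_i`. -/
theorem privacy_cost (d : ℕ) (hd : 1 ≤ d) (n : Fin d → ℕ) (hn : ∀ k, 2 ≤ n k)
    (τ : Finset (Fin d)) :
    IsUnit (Tmat n τ τ * (Tmat n τ τ)ᵀ) ∧
    ∀ j : ∀ k, Fin (n k),
      ((Rmat n τ)ᵀ * (Tmat n τ τ * (Tmat n τ τ)ᵀ)⁻¹ * Rmat n τ) j j =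
        ∏ i ∈ τ, ((n i : ℝ) - 1) / (n i : ℝ) := by
  have h := Tmat_gram_mul_inv hn τ
  refine ⟨IsUnit.of_mul_eq_one _ h, fun j => ?_⟩
  rw [Matrix.inv_eq_right_inv h, Rmat_eq_piKronecker, piKronecker_transpose, piKronecker_mul,
    piKronecker_mul]
  simp only [piKronecker, Matrix.of_apply,
    factorMatrix_transpose_mul_inv_mul_apply_self _ (hn _) (rfl : rIdx n τ _ = _)]
  simp
end

section
/- (Closed-form solution of the relaxed conditional ResidualPlanner problem.) Let T be a nonempty finite index set and let v_τ > 0, p_τ > 0, a_τ > 0 for τ ∈ T. Set S = ∑_{τ ∈ T} √(p_τ v_τ) and Q = ∑_{τ ∈ T} p_τ a_τ, and define x*_τ = ((1 + Q)/S)·√(v_τ/p_τ) − a_τ. Then: (i) x* is feasible for the equality-constrained problem, i.e. ∑_{τ ∈ T} p_τ x*_τ = 1; (ii) x*_τ + a_τ > 0 for every τ; and (iii) for every x : T → ℝ with ∑_{τ ∈ T} p_τ x_τ = 1 and x_τ + a_τ > 0 for all τ, one has ∑_{τ ∈ T} v_τ/(x*_τ + a_τ) ≤ ∑_{τ ∈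 T} v_τ/(x_τ + a_τ). That is, x* minimizes the objective ∑_τ v_τ/(x_τ + a_τ) subject to the budget equality constraint ∑_τ p_τ x_τ = 1. -/
open Finset

/-- (Closed-form solution of the relaxed conditional ResidualPlanner problem.)
Let `T` be a nonempty finite index set, `v_τ, p_τ, a_τ > 0`,
`S = ∑ √(p_τ v_τ)`, `Q = ∑ p_τ a_τ`, and
`x*_τ = ((1 + Q)/S)·√(v_τ/p_τ) − a_τ`. Then `x*` satisfies the budget
equality `∑ p_τ x*_τ = 1`, has `x*_τ + a_τ > 0` for all `τ`, and minimizes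
`∑ v_τ/(x_τ + a_τ)` among all `x` with `∑ p_τ x_τ = 1` and `x_τ + a_τ > 0`. -/
theorem relaxed_crp_solution {T : Type*} [Fintype T] [Nonempty T]
    (v p a : T → ℝ) (hv : ∀ τ, 0 < v τ) (hp : ∀ τ, 0 < p τ)
    (ha : ∀ τ, 0 < a τ) :
    let S : ℝ := ∑ τ, Real.sqrt (p τ * v τ)
    let Q : ℝ := ∑ τ, p τ * a τ
    let xs : T → ℝ := fun τ => ((1 + Q) / S) * Real.sqrt (v τ / p τ) - a τ
    (∑ τ, p τ * xs τ = 1) ∧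
    (∀ τ, 0 < xs τ + a τ) ∧
    (∀ x : T → ℝ, (∑ τ, p τ * x τ = 1) → (∀ τ, 0 < x τ + a τ) →
      ∑ τ, v τ / (xs τ + a τ) ≤ ∑ τ, v τ / (x τ + a τ)) := by
  intro S Q xs
  have hS : 0 < S :=
    Finset.sum_pos (fun τ _ => Real.sqrt_pos.2 (mul_pos (hp τ) (hv τ))) Finset.univ_nonempty
  have hQ : 0 < 1 + Q :=
    add_pos_of_pos_of_nonneg one_pos
      (Finset.sum_nonneg fun τ _ => (mul_pos (hp τ) (ha τ)).le)
  have hc : 0 < (1 + Q) / S := div_pos hQ hS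
  have hsqrt : ∀ τ, 0 < √(v τ / p τ) := fun τ => Real.sqrt_pos.2 (div_pos (hv τ) (hp τ))
  have hweight : ∀ τ, √(p τ * v τ) = p τ * √(v τ / p τ) := fun τ => by
    have h : p τ * v τ = p τ ^ 2 * (v τ / p τ) := by
      have := (hp τ).ne'
      field_simp
    rw [h, Real.sqrt_mul (sq_nonneg _), Real.sqrt_sq (hp τ).le]
  have hadd : ∀ τ, xs τ + a τ = (1 + Q) / S * √(v τ / p τ) := fun τ => sub_add_cancel _ _
  have hterm : ∀ τ, v τ / (xs τ + a τ) = √(p τ * v τ) / ((1 + Q) / S) := fun τ => by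
    rw [hadd, hweight, div_eq_div_iff (mul_pos hc (hsqrt τ)).ne' hc.ne']
    have h : p τ * (√(v τ / p τ) * √(v τ / p τ)) = v τ := by
      rw [Real.mul_self_sqrt (div_pos (hv τ) (hp τ)).le, mul_div_cancel₀ _ (hp τ).ne']
    linear_combination (-((1 + Q) / S)) * h
  refine ⟨?_, fun τ => hadd τ ▸ mul_pos hc (hsqrt τ), fun x hx hpos => ?_⟩
  · calc ∑ τ, p τ * xs τ
        = ∑ τ, ((1 + Q) / S * √(p τ * v τ) - p τ * a τ) :=
          Finset.sum_congr rfl fun τ _ => by simp only [xs, hweight]; ring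
      _ = (1 + Q) / S * S - Q := by rw [Finset.sum_sub_distrib, ← Finset.mul_sum]
      _ = 1 := by rw [div_mul_cancel₀ _ hS.ne']; ring
  · have hbudget : ∑ τ, p τ * (x τ + a τ) = 1 + Q := by
      simp only [mul_add, Finset.sum_add_distrib, hx, Q]
    calc ∑ τ, v τ / (xs τ + a τ)
        = S / ((1 + Q) / S) := by simp only [hterm, ← Finset.sum_div, S]
      _ = (∑ τ, √(p τ * v τ)) ^ 2 / ∑ τ, p τ * (x τ + a τ) := by
          rw [hbudget, div_div_eq_mul_div, ← sq]
      _ ≤ ∑ τ, √(p τ * v τ) ^ 2 / (p τ * (x τ + a τ)) :=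
          Finset.sq_sum_div_le_sum_sq_div _ _ fun τ _ => mul_pos (hp τ) (hpos τ)
      _ = ∑ τ, v τ / (x τ + a τ) :=
          Finset.sum_congr rfl fun τ _ => by
            rw [Real.sq_sqrt (mul_pos (hp τ) (hv τ)).le, mul_div_mul_left _ _ (hp τ).ne']
end
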